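/- Let G be a finite triangle-free graph with minimum degree d ≥ 1, and let S be a stable set of G chosen uniformly at random among all stable sets. Then E[Σ_{v ∈ S} deg(v)] ≥ (1/4)·Σ_{v ∈ V(G)} log(deg(v)). -/

import Mathlib

open Finset

/-- Twice the total size of the subsets of a finset. -/
theorem two_mul_sum_card_powerset {α : Type*} [DecidableEq α] (X : Finset α) :
    2 * ∑ T ∈ X.powerset, (T.card : ℝ) = X.card * 2 ^ X.card := by
  induction X using Finset.induction_on with
  | empty => simp
  | insert a X ha ih =>
    rw [Finset.sum_powerset_insert ha]
    have h : ∑ T ∈ X.powerset, ((insert a T).card : ℝ) = ∑ T ∈ X.powerset, ((T.card : ℝ) + 1) := by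
      refine Finset.sum_congr rfl fun T hT => ?_
      rw [Finset.card_insert_of_notMem fun h => ha (Finset.mem_powerset.1 hT h)]
      push_cast
      rfl
    rw [h, Finset.sum_add_distrib, Finset.card_insert_of_notMem ha]
    simp only [Finset.sum_const, Finset.card_powerset, nsmul_eq_mul]
    push_cast
    linear_combination 2 * ih

theorem two_pow_add_one_mul_log_le {D : ℝ} (hD : 0 < D) (x : ℕ) :
    (2 ^ x + 1) * Real.log D ≤ 2 * D + x * 2 ^ x := by
  have hp : (0 : ℝ) < 2 ^ x := by positivity
  have hx : (x : ℝ) ≤ 2 ^ x := by exact_mod_cast Nat.lt_two_pow_self.le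
  have h1 : Real.log (D / ((2 ^ x + 1) / 2)) ≤ D / ((2 ^ x + 1) / 2) - 1 :=
    Real.log_le_sub_one_of_pos (by positivity)
  rw [Real.log_div hD.ne' (by positivity)] at h1
  have h2 : Real.log (((2 : ℝ) ^ x + 1) / 2) ≤ x := by
    calc Real.log (((2 : ℝ) ^ x + 1) / 2) ≤ Real.log (2 ^ x) := by
          apply Real.log_le_log (by positivity)
          have : (1 : ℝ) ≤ 2 ^ x := one_le_pow₀ (by norm_num)
          linarith
      _ = x * Real.log 2 := Real.log_pow _ _
      _ ≤ x * 1 := by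
          gcongr
          linarith [Real.log_two_lt_d9]
      _ = x := mul_one _
  have h3 : Real.log D ≤ D / ((2 ^ x + 1) / 2) - 1 + x := by linarith
  calc (2 ^ x + 1) * Real.log D ≤ (2 ^ x + 1) * (D / ((2 ^ x + 1) / 2) - 1 + x) := by gcongr
    _ = 2 * D - (2 ^ x + 1) + x * (2 ^ x + 1) := by field_simp
    _ ≤ 2 * D + x * 2 ^ x := by linarith

namespace SimpleGraph

variable {V : Type*} [Fintype V] [DecidableEq V] (G : SimpleGraph V) [DecidableRel G.Adj]

/-- The finset of all stable sets of a graph. -/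
def stableSets : Finset (Finset V) :=
  Finset.univ.filter fun S : Finset V => ∀ x ∈ S, ∀ y ∈ S, ¬ G.Adj x y

variable {G}

theorem mem_stableSets {S : Finset V} :
    S ∈ G.stableSets ↔ ∀ x ∈ S, ∀ y ∈ S, ¬ G.Adj x y := by
  simp [stableSets]

/-- In a triangle-free graph, the stable sets with a given trace `H` outside the closed
neighbourhood of `v` are `H ∪ {v}` and the sets `H ∪ T`, with `T` any set of neighbours of `v`
that have no neighbour in `H`. -/
theorem filter_stableSets_eq (htf : G.CliqueFree 3) (v : V) {H : Finset V}
    (hH : H ∈ G.stableSets) (hHv : Disjoint H (insert v (G.neighborFinset v))) :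
    G.stableSets.filter (fun S => S \ insert v (G.neighborFinset v) = H) =
      insert (insert v H)
        (((G.neighborFinset v).filter fun u => ∀ w ∈ H, ¬ G.Adj u w).powerset.image (H ∪ ·)) := by
  have hN : ∀ a b, G.Adj v a → G.Adj v b → ¬ G.Adj a b := fun a b ha hb hab =>
    htf {v, a, b} (is3Clique_triple_iff.2 ⟨ha, hb, hab⟩)
  have hHd : ∀ w ∈ H, w ≠ v ∧ ¬ G.Adj v w := fun w hw => by
    have := Finset.disjoint_left.1 hHv hw
    simpa using this
  rw [mem_stableSets] at hH
  ext S
  simp only [Finset.mem_filter, Finset.mem_insert, Finset.mem_image, Finset.mem_powerset]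
  constructor
  · rintro ⟨hS, hSH⟩
    rw [mem_stableSets] at hS
    have hmem : ∀ w, w ∈ H ↔ w ∈ S ∧ w ≠ v ∧ ¬ G.Adj v w := fun w => by
      rw [← hSH]; simp
    by_cases hv : v ∈ S
    · left
      ext w
      have := hS v hv w
      have := hmem w
      grind
    · right
      refine ⟨S ∩ G.neighborFinset v, fun u hu => ?_, ?_⟩
      · simp only [Finset.mem_inter, Finset.mem_filter, mem_neighborFinset] at hu ⊢
        exact ⟨hu.2, fun w hw => hS u hu.1 w ((hmem w).1 hw).1⟩
      · ext w
        have := hmem w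
        simp only [Finset.mem_union, Finset.mem_inter, mem_neighborFinset]
        grind
  · rintro (rfl | ⟨T, hT, rfl⟩)
    · constructor
      · rw [mem_stableSets]
        intro x hx y hy hxy
        have := hxy.ne
        have := hxy.symm
        grind
      · ext w
        have := hHd w
        simp only [Finset.mem_sdiff, Finset.mem_insert, mem_neighborFinset]
        grind
    · have hT' : ∀ u ∈ T, G.Adj v u ∧ ∀ w ∈ H, ¬ G.Adj u w := fun u hu => by
        simpa using hT hu
      constructor
      · rw [mem_stableSets]
        intro x hx y hy hxy
        have := hxy.symm
        rcases Finset.mem_union.1 hx with hx | hx <;> rcases Finset.mem_union.1 hy with hy | hy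
        · exact hH x hx y hy hxy
        · exact (hT' y hy).2 x hx this
        · exact (hT' x hx).2 y hy hxy
        · exact hN x y (hT' x hx).1 (hT' y hy).1 hxy
      · ext w
        have := hHd w
        have := hT' w
        simp only [Finset.mem_sdiff, Finset.mem_insert, mem_neighborFinset, Finset.mem_union]
        grind

theorem card_mul_log_degree_le_of_fiber (htf : G.CliqueFree 3) {v : V} (hv : 0 < G.degree v)
    {H : Finset V} (hH : H ∈ G.stableSets)
    (hHv : Disjoint H (insert v (G.neighborFinset v))) :
    ((G.stableSets.filter fun S => S \ insert v (G.neighborFinset v) = H).card : ℝ) *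
        Real.log (G.degree v) ≤
      2 * ∑ S ∈ G.stableSets.filter (fun S => S \ insert v (G.neighborFinset v) = H),
        ((if v ∈ S then (G.degree v : ℝ) else 0) + (S ∩ G.neighborFinset v).card) := by
  rw [filter_stableSets_eq htf v hH hHv]
  set X := (G.neighborFinset v).filter fun u => ∀ w ∈ H, ¬ G.Adj u w
  have hXN : X ⊆ G.neighborFinset v := Finset.filter_subset _ _
  have hvN : v ∉ G.neighborFinset v := by simp
  have hvH : v ∉ H := fun h => Finset.disjoint_left.1 hHv h (Finset.mem_insert_self _ _)
  have hHN : H ∩ G.neighborFinset v = ∅ :=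
    Finset.disjoint_iff_inter_eq_empty.1 (hHv.mono_right (Finset.subset_insert _ _))
  have hHT : ∀ T ⊆ X, (H ∪ T) ∩ G.neighborFinset v = T := fun T hT => by
    rw [Finset.union_inter_distrib_right, hHN, Finset.empty_union,
      Finset.inter_eq_left.2 (hT.trans hXN)]
  have hvT : ∀ T ⊆ X, v ∉ H ∪ T := fun T hT h =>
    (Finset.mem_union.1 h).elim hvH fun h => hvN (hXN (hT h))
  have hinj : Set.InjOn (H ∪ ·) (X.powerset : Set (Finset V)) := fun T hT T' hT' h => by
    rw [← hHT T (by simpa using hT), ← hHT T' (by simpa using hT')]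
    exact congrArg (· ∩ G.neighborFinset v) h
  have hnot : insert v H ∉ X.powerset.image (H ∪ ·) := fun h => by
    obtain ⟨T, hT, h⟩ := Finset.mem_image.1 h
    exact hvT T (Finset.mem_powerset.1 hT) (h ▸ Finset.mem_insert_self v H)
  have hsum : ∑ T ∈ X.powerset, ((if v ∈ H ∪ T then (G.degree v : ℝ) else 0) +
      ((H ∪ T) ∩ G.neighborFinset v).card) = ∑ T ∈ X.powerset, (T.card : ℝ) :=
    Finset.sum_congr rfl fun T hT => by
      rw [hHT T (Finset.mem_powerset.1 hT), if_neg (hvT T (Finset.mem_powerset.1 hT)), zero_add]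
  rw [Finset.card_insert_of_notMem hnot, Finset.card_image_of_injOn hinj, Finset.card_powerset,
    Finset.sum_insert hnot, Finset.sum_image hinj, hsum, mul_add, two_mul_sum_card_powerset,
    if_pos (Finset.mem_insert_self v H), Finset.insert_inter_of_notMem hvN, hHN]
  have := two_pow_add_one_mul_log_le (D := G.degree v) (by exact_mod_cast hv) X.card
  push_cast
  simpa using this

theorem card_stableSets_mul_log_degree_le (htf : G.CliqueFree 3) {v : V}
    (hv : 0 < G.degree v) :
    (G.stableSets.card : ℝ) * Real.log (G.degree v) ≤
      2 * ∑ S ∈ G.stableSets,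
        ((if v ∈ S then (G.degree v : ℝ) else 0) + (S ∩ G.neighborFinset v).card) := by
  have hmaps : ∀ S ∈ G.stableSets, S \ insert v (G.neighborFinset v) ∈
      G.stableSets.image (· \ insert v (G.neighborFinset v)) :=
    fun S hS => Finset.mem_image_of_mem _ hS
  rw [Finset.card_eq_sum_card_fiberwise hmaps, ← Finset.sum_fiberwise_of_maps_to hmaps,
    Finset.mul_sum, Nat.cast_sum, Finset.sum_mul]
  refine Finset.sum_le_sum fun H hH => ?_
  obtain ⟨S, hS, rfl⟩ := Finset.mem_image.1 hH
  refine card_mul_log_degree_le_of_fiber htf hv ?_ Finset.sdiff_disjoint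
  rw [mem_stableSets] at hS ⊢
  exact fun x hx y hy => hS x (Finset.mem_sdiff.1 hx).1 y (Finset.mem_sdiff.1 hy).1

theorem sum_card_inter_neighborFinset (S : Finset V) :
    ∑ v, ((S ∩ G.neighborFinset v).card : ℝ) = ∑ v ∈ S, (G.degree v : ℝ) := by
  norm_cast
  have h := Finset.sum_card_bipartiteAbove_eq_sum_card_bipartiteBelow (s := S)
    (t := (Finset.univ : Finset V)) G.Adj
  convert h.symm using 2 with v _ v _
  · congr 1
    ext u
    simp [Finset.bipartiteBelow, G.adj_comm]
  · rw [← card_neighborFinset_eq_degree]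
    congr 1
    ext u
    simp [Finset.bipartiteAbove]

end SimpleGraph

/-- Let `G` be a finite triangle-free graph with minimum degree `d ≥ 1`, and let `S` be a
stable set of `G` chosen uniformly at random among all stable sets. Then
`E[∑_{v ∈ S} deg(v)] ≥ (1/4)·∑_{v ∈ V(G)} log(deg(v))`. -/
theorem stmt_11 {V : Type*} [Fintype V] [DecidableEq V] (G : SimpleGraph V)
    [DecidableRel G.Adj] (htf : G.CliqueFree 3) (d : ℕ) (hd : 1 ≤ d)
    (hmin : ∀ v : V, d ≤ G.degree v) :
    (1 / 4) * ∑ v : V, Real.log (G.degree v) ≤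
      (∑ S ∈ (Finset.univ.filter fun S : Finset V => ∀ x ∈ S, ∀ y ∈ S, ¬ G.Adj x y),
        ∑ v ∈ S, (G.degree v : ℝ)) /
      ((Finset.univ.filter fun S : Finset V => ∀ x ∈ S, ∀ y ∈ S, ¬ G.Adj x y).card : ℝ) := by
  have hpos : (0 : ℝ) < (G.stableSets.card : ℝ) := by
    exact_mod_cast Finset.card_pos.2 ⟨∅, SimpleGraph.mem_stableSets.2 (by simp)⟩
  change _ ≤ (∑ S ∈ G.stableSets, ∑ v ∈ S, (G.degree v : ℝ)) / (G.stableSets.card : ℝ)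
  rw [le_div_iff₀ hpos]
  have key := Finset.sum_le_sum fun v (_ : v ∈ (Finset.univ : Finset V)) =>
    SimpleGraph.card_stableSets_mul_log_degree_le htf (lt_of_lt_of_le hd (hmin v))
  rw [← Finset.mul_sum, ← Finset.mul_sum, Finset.sum_comm] at key
  simp only [Finset.sum_add_distrib, SimpleGraph.sum_card_inter_neighborFinset,
    Finset.sum_ite_mem, Finset.univ_inter] at key
  linarith
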